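/- arXiv:1503.01251 — 4 statements merged into one kernel-verified Lean document; each statement's English description precedes it below -/
import Mathlib

section
/- Let H be a real endomorphism of V ⊕ V* with H² = -Id which is g-symmetric (g(Hu, v) = g(u, Hv) for all u, v), and suppose the bilinear form on V* given by (α, β) ↦ 2 g(H(0,α), (0,β)) is nondegenerate. Then there exist a unique nondegenerate symmetric bilinear form γ₀ on V and a unique antisymmetric bilinear form ψ on V such that the i-eigenspace of the complexification of H acting on (V ⊕ V*)^ℂ equals { (X, α) : X ∈ V^ℂ, α(Y) = ψ^ℂ(X,Y) + i γ₀^ℂ(X,Y) for all Y ∈ V^ℂ }, i.e. it is the graph of the map τ : X ↦ (X, ψ^ℂ(X,·) + i γ₀^ℂ(X,·)). -/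
noncomputable section

open TensorProduct

attribute [local instance 3000] TensorProduct.addCommMonoid TensorProduct.leftModule

/-- The "big tangent space" `V ⊕ V*`. -/
abbrev Big (V : Type) [AddCommGroup V] [Module ℝ V] : Type := V × Module.Dual ℝ V

variable (V : Type) [AddCommGroup V] [Module ℝ V]

/-- The pairing metric `g((X,α),(Y,β)) = (α Y + β X)/2` on `V ⊕ V*`. -/
def gP : Big V →ₗ[ℝ] Big V →ₗ[ℝ] ℝ :=
  LinearMap.mk₂ ℝ (fun u v => (u.2 v.1 + v.2 u.1) / 2)
    (fun m₁ m₂ n => by simp; ring)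
    (fun c m n => by simp; ring)
    (fun m n₁ n₂ => by simp; ring)
    (fun c m n => by simp; ring)

/-- A generalized almost para-complex structure on `V`. -/
def IsGenParaCx (F : Big V →ₗ[ℝ] Big V) : Prop :=
  F ∘ₗ F = LinearMap.id ∧ ∀ u v, gP V (F u) v = - gP V u (F v)

/-- A generalized almost complex structure on `V`. -/
def IsGenCx (J : Big V →ₗ[ℝ] Big V) : Prop :=
  J ∘ₗ J = - LinearMap.id ∧ ∀ u v, gP V (J u) v = - gP V u (J v)

/-- The bilinear form `γ(α,β) = -2 g(𝓕(0,α), 𝓙(0,β))` on `V*`. -/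
def gammaOf (F J : Big V →ₗ[ℝ] Big V) (α β : Module.Dual ℝ V) : ℝ :=
  -2 * gP V (F (0, α)) (J (0, β))

/-- A generalized almost para-Hermitian structure on `V`: a commuting pair of a
generalized almost para-complex structure and a generalized almost complex structure
whose associated bilinear form `γ` on `V*` is nondegenerate. -/
def IsGAPH (F J : Big V →ₗ[ℝ] Big V) : Prop :=
  IsGenParaCx V F ∧ IsGenCx V J ∧ F ∘ₗ J = J ∘ₗ F ∧
    ∀ α, (∀ β, gammaOf V F J α β = 0) → α = 0

/-- Complexification of `V`. -/
abbrev Vc : Type := ℂ ⊗[ℝ] V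

/-- Complexification of the big space `V ⊕ V*`. -/
abbrev Bc : Type := ℂ ⊗[ℝ] Big V

/-- The projection `(V ⊕ V*)^ℂ → V^ℂ`. -/
def prV : Bc V →ₗ[ℂ] Vc V := LinearMap.baseChange ℂ (LinearMap.fst ℝ V (Module.Dual ℝ V))

/-- The inclusion `V^ℂ → (V ⊕ V*)^ℂ`, `X ↦ (X, 0)`. -/
def inV : Vc V →ₗ[ℂ] Bc V := LinearMap.baseChange ℂ (LinearMap.inl ℝ V (Module.Dual ℝ V))

/-- The complexified pairing metric on `(V ⊕ V*)^ℂ`. -/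
def gc : Bc V →ₗ[ℂ] Bc V →ₗ[ℂ] ℂ := LinearMap.BilinForm.baseChange ℂ (gP V)

/-- Complex-bilinear extension of a bilinear form on `V` to `V^ℂ`. -/
def bcB (B : LinearMap.BilinForm ℝ V) : Vc V →ₗ[ℂ] Vc V →ₗ[ℂ] ℂ :=
  LinearMap.BilinForm.baseChange ℂ B

/-- The `μ`-eigenspace of an endomorphism of `(V ⊕ V*)^ℂ`. -/
def eigSp (T : Bc V →ₗ[ℂ] Bc V) (μ : ℂ) : Submodule ℂ (Bc V) where
  carrier := {u | T u = μ • u}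
  add_mem' := by
    intro a b ha hb
    simp only [Set.mem_setOf_eq, map_add] at *
    rw [ha, hb, smul_add]
  zero_mem' := by simp
  smul_mem' := by
    intro c u hu
    simp only [Set.mem_setOf_eq, map_smul] at *
    rw [hu, smul_comm]

/-- The `i`-eigenspace of the complexification of an endomorphism of `V ⊕ V*`. -/
def Hsp (H : Big V →ₗ[ℝ] Big V) : Submodule ℂ (Bc V) :=
  eigSp V (LinearMap.baseChange ℂ H) Complex.I

/-- The `+1`-eigenspace of the complexification of an endomorphism of `V ⊕ V*`. -/
def Fplus (F : Big V →ₗ[ℝ] Big V) : Submodule ℂ (Bc V) :=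
  eigSp V (LinearMap.baseChange ℂ F) 1

/-- The `-1`-eigenspace of the complexification of an endomorphism of `V ⊕ V*`. -/
def Fminus (F : Big V →ₗ[ℝ] Big V) : Submodule ℂ (Bc V) :=
  eigSp V (LinearMap.baseChange ℂ F) (-1)

/-- The graph `{(X, ψ^ℂ(X,·) + i γ₀^ℂ(X,·)) : X ∈ V^ℂ}` inside `(V ⊕ V*)^ℂ`.
An element `u = (X, α)` lies on the graph iff `α(Y) = ψ^ℂ(X,Y) + i γ₀^ℂ(X,Y)` for all
`Y ∈ V^ℂ`; the value `α(Y)` is expressed canonically as `2 g^ℂ(u, (Y,0))`. -/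
def graphSet (γ₀ ψ : LinearMap.BilinForm ℝ V) : Set (Bc V) :=
  {u | ∀ Y : Vc V, 2 * gc V u (inV V Y) =
      bcB V ψ (prV V u) Y + Complex.I * bcB V γ₀ (prV V u) Y}

/-- Complex conjugation of `(V ⊕ V*)^ℂ` with respect to the real form `V ⊕ V*`. -/
def conjMap : Bc V →ₗ[ℝ] Bc V := LinearMap.rTensor (Big V) Complex.conjAe.toLinearMap

/-- The complex conjugate of a complex subspace of `(V ⊕ V*)^ℂ` (the image of the
subspace under conjugation; taking the `ℂ`-span does not enlarge the image, since the
image of a complex subspace under conjugation is again a complex subspace). -/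
def conjSub (S : Submodule ℂ (Bc V)) : Submodule ℂ (Bc V) :=
  Submodule.span ℂ (conjMap V '' (S : Set (Bc V)))

noncomputable instance (S : Submodule ℂ (Bc V)) : AddCommGroup ↥S :=
  Module.addCommMonoidToAddCommGroup ℂ

/-- A `g`-isotropic subspace of `(V ⊕ V*)^ℂ`. -/
def IsIsotropic (S : Submodule ℂ (Bc V)) : Prop := ∀ u ∈ S, ∀ v ∈ S, gc V u v = 0

/-- A maximal `g`-isotropic subspace of `(V ⊕ V*)^ℂ`: a `g`-isotropic subspace of
complex dimension `dim V`. -/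
def MaxIsotropic (S : Submodule ℂ (Bc V)) : Prop :=
  IsIsotropic V S ∧ Module.finrank ℂ S = Module.finrank ℝ V

/-- The endomorphism of `V^ℂ` induced by an endomorphism `A` of `V ⊕ V*` via `τ`:
`X ↦ pr_{V^ℂ} (A^ℂ (τ X))`. -/
def Fop (A : Big V →ₗ[ℝ] Big V) (τ : Vc V →ₗ[ℂ] Bc V) : Vc V → Vc V :=
  fun X => prV V (LinearMap.baseChange ℂ A (τ X))

/-- The canonical (real) inclusion `V → V^ℂ`. -/
def realIncl : V →ₗ[ℝ] Vc V := TensorProduct.mk ℝ ℂ V 1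

/-- The canonical (real) inclusion `V ⊕ V* → (V ⊕ V*)^ℂ`. -/
def realInclB : Big V →ₗ[ℝ] Bc V := TensorProduct.mk ℝ ℂ (Big V) 1

/-- The B-field transformation `(X, α) ↦ (X, α + B(X,·))` of `V ⊕ V*`. -/
def Bfield (B : LinearMap.BilinForm ℝ V) : Big V →ₗ[ℝ] Big V :=
  LinearMap.prod (LinearMap.fst ℝ V (Module.Dual ℝ V))
    (LinearMap.snd ℝ V (Module.Dual ℝ V) + B ∘ₗ LinearMap.fst ℝ V (Module.Dual ℝ V))

/-- `(X, α) ↦ (F X, -α ∘ F)`. -/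
def genF (F : V →ₗ[ℝ] V) : Big V →ₗ[ℝ] Big V := F.prodMap (- F.dualMap)

/-- `(X, α) ↦ (♯ α, -γ₀(X,·))`. -/
def genH (γ₀ : LinearMap.BilinForm ℝ V) (sharp : Module.Dual ℝ V →ₗ[ℝ] V) :
    Big V →ₗ[ℝ] Big V :=
  LinearMap.prod (sharp ∘ₗ LinearMap.snd ℝ V (Module.Dual ℝ V))
    (- (γ₀ ∘ₗ LinearMap.fst ℝ V (Module.Dual ℝ V)))

/-- The projection `(1/4)(Id + 𝓕^ℂ) ∘ (Id - i 𝓗^ℂ)` onto `𝐇₊`, as a function. -/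
def prHplus (F H : Big V →ₗ[ℝ] Big V) (u : Bc V) : Bc V :=
  ((1 : ℂ)/4) • ((u - Complex.I • LinearMap.baseChange ℂ H u) +
    LinearMap.baseChange ℂ F (u - Complex.I • LinearMap.baseChange ℂ H u))

/-- The projection `(1/4)(Id - 𝓕^ℂ) ∘ (Id - i 𝓗^ℂ)` onto `𝐇₋`, as a function. -/
def prHminus (F H : Big V →ₗ[ℝ] Big V) (u : Bc V) : Bc V :=
  ((1 : ℂ)/4) • ((u - Complex.I • LinearMap.baseChange ℂ H u) -
    LinearMap.baseChange ℂ F (u - Complex.I • LinearMap.baseChange ℂ H u))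

/-- The inclusion `W ⊕ V* → V ⊕ V*` over a subspace `W ⊆ V`. -/
def bigIncl (W : Submodule ℝ V) : (↥W × Module.Dual ℝ V) →ₗ[ℝ] Big V :=
  (W.subtype).prodMap LinearMap.id

/-- The restriction `W ⊕ V* → W ⊕ W*`, restricting functionals to `W`. -/
def bigRes (W : Submodule ℝ V) : (↥W × Module.Dual ℝ V) →ₗ[ℝ] Big ↥W :=
  LinearMap.prodMap LinearMap.id (W.subtype.dualMap)

/-- The pullback `ι*U = {(X, η∘ι) : X ∈ W^ℂ, (X, η) ∈ U}` of a subspace of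
`(V ⊕ V*)^ℂ` to `(W ⊕ W*)^ℂ`. -/
def pullback (W : Submodule ℝ V) (U : Submodule ℂ (Bc V)) : Submodule ℂ (Bc ↥W) :=
  Submodule.map (LinearMap.baseChange ℂ (bigRes V W))
    (Submodule.comap (LinearMap.baseChange ℂ (bigIncl V W)) U)

/-- Restriction of a bilinear form on `V` to a subspace `W`. -/
def resB (W : Submodule ℝ V) (B : LinearMap.BilinForm ℝ V) : LinearMap.BilinForm ℝ ↥W :=
  B.compl₁₂ W.subtype W.subtype

section Complexification

variable {W : Type} [AddCommGroup W] [Module ℝ W]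

theorem exists_eq_one_tmul_add_I_tmul (u : ℂ ⊗[ℝ] W) :
    ∃ a b : W, u = (1 : ℂ) ⊗ₜ[ℝ] a + Complex.I ⊗ₜ[ℝ] b := by
  induction u using TensorProduct.induction_on with
  | zero => exact ⟨0, 0, by simp⟩
  | tmul z w =>
    refine ⟨z.re • w, z.im • w, ?_⟩
    rw [← TensorProduct.smul_tmul, ← TensorProduct.smul_tmul, ← TensorProduct.add_tmul]
    congr 1
    apply Complex.ext <;> simp
  | add u v hu hv =>
    obtain ⟨a, b, rfl⟩ := hu
    obtain ⟨c, d, rfl⟩ := hv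
    refine ⟨a + c, b + d, ?_⟩
    rw [TensorProduct.tmul_add, TensorProduct.tmul_add]
    abel

theorem one_tmul_add_I_tmul_inj {a b c d : W} :
    (1 : ℂ) ⊗ₜ[ℝ] a + Complex.I ⊗ₜ[ℝ] b = (1 : ℂ) ⊗ₜ[ℝ] c + Complex.I ⊗ₜ[ℝ] d ↔
      a = c ∧ b = d := by
  refine ⟨fun h => ?_, fun ⟨h₁, h₂⟩ => by rw [h₁, h₂]⟩
  have hre := congrArg ((TensorProduct.lid ℝ W).toLinearMap ∘ₗ LinearMap.rTensor W Complex.reLm) h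
  have him := congrArg ((TensorProduct.lid ℝ W).toLinearMap ∘ₗ LinearMap.rTensor W Complex.imLm) h
  simp at hre him
  exact ⟨hre, him⟩

theorem I_smul_one_tmul_add_I_tmul (a b : W) :
    Complex.I • ((1 : ℂ) ⊗ₜ[ℝ] a + Complex.I ⊗ₜ[ℝ] b) =
      (1 : ℂ) ⊗ₜ[ℝ] (-b) + Complex.I ⊗ₜ[ℝ] a := by
  rw [smul_add, TensorProduct.smul_tmul', TensorProduct.smul_tmul', smul_eq_mul, smul_eq_mul,
    Complex.I_mul_I, mul_one, TensorProduct.neg_tmul, TensorProduct.tmul_neg, add_comm]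

end Complexification

section

variable {V}

theorem mem_Hsp_iff (H : Big V →ₗ[ℝ] Big V) (a b : Big V) :
    (1 : ℂ) ⊗ₜ[ℝ] a + Complex.I ⊗ₜ[ℝ] b ∈ (Hsp V H : Set (Bc V)) ↔ H a = -b ∧ H b = a := by
  change LinearMap.baseChange ℂ H _ = Complex.I • _ ↔ _
  rw [I_smul_one_tmul_add_I_tmul, map_add, LinearMap.baseChange_tmul, LinearMap.baseChange_tmul,
    one_tmul_add_I_tmul_inj]

theorem mem_graphSet_iff (γ₀ ψ : LinearMap.BilinForm ℝ V) (a b : Big V) :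
    (1 : ℂ) ⊗ₜ[ℝ] a + Complex.I ⊗ₜ[ℝ] b ∈ graphSet V γ₀ ψ ↔
      a.2 = ψ a.1 - γ₀ b.1 ∧ b.2 = ψ b.1 + γ₀ a.1 := by
  have key : ∀ (z : ℂ) (y : V),
      2 * gc V ((1 : ℂ) ⊗ₜ[ℝ] a + Complex.I ⊗ₜ[ℝ] b) (inV V (z ⊗ₜ[ℝ] y)) =
        z * ((a.2 y : ℂ) + Complex.I * (b.2 y : ℂ)) ∧
      bcB V ψ (prV V ((1 : ℂ) ⊗ₜ[ℝ] a + Complex.I ⊗ₜ[ℝ] b)) (z ⊗ₜ[ℝ] y) +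
        Complex.I * bcB V γ₀ (prV V ((1 : ℂ) ⊗ₜ[ℝ] a + Complex.I ⊗ₜ[ℝ] b)) (z ⊗ₜ[ℝ] y) =
        z * (((ψ a.1 y - γ₀ b.1 y : ℝ) : ℂ) + Complex.I * ((ψ b.1 y + γ₀ a.1 y : ℝ) : ℂ)) := by
    intro z y
    constructor
    · simp [gc, inV, gP]
      ring
    · simp [bcB, prV]
      linear_combination z * (γ₀ b.1 y : ℂ) * Complex.I_mul_I
  constructor
  · intro h
    have hy : ∀ y, a.2 y = ψ a.1 y - γ₀ b.1 y ∧ b.2 y = ψ b.1 y + γ₀ a.1 y := by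
      intro y
      have h₁ := h ((1 : ℂ) ⊗ₜ[ℝ] y)
      rw [(key 1 y).1, (key 1 y).2] at h₁
      have hre := congrArg Complex.re h₁
      have him := congrArg Complex.im h₁
      simp at hre him
      exact ⟨hre, him⟩
    exact ⟨LinearMap.ext fun y => (hy y).1, LinearMap.ext fun y => (hy y).2⟩
  · rintro ⟨h₁, h₂⟩ Y
    induction Y using TensorProduct.induction_on with
    | zero => simp
    | tmul z y =>
      rw [(key z y).1, (key z y).2, h₁, h₂]
      rfl
    | add Y Z hY hZ =>
      simp only [map_add] at hY hZ ⊢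
      linear_combination hY + hZ

theorem graphSet_injective {γ₀ ψ γ₁ ψ₁ : LinearMap.BilinForm ℝ V}
    (h : graphSet V γ₀ ψ = graphSet V γ₁ ψ₁) : γ₀ = γ₁ ∧ ψ = ψ₁ := by
  have hx : ∀ x, ψ x = ψ₁ x ∧ γ₀ x = γ₁ x := by
    intro x
    have hmem := (mem_graphSet_iff γ₀ ψ (x, ψ x) (0, γ₀ x)).2 (by simp)
    rw [h, mem_graphSet_iff] at hmem
    simpa using hmem
  exact ⟨LinearMap.ext fun x => (hx x).2, LinearMap.ext fun x => (hx x).1⟩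

theorem gP_apply (u v : Big V) : gP V u v = (u.2 v.1 + v.2 u.1) / 2 := rfl

/-- The `V* → V` component of an endomorphism of `V ⊕ V*`. -/
def sharpOf (H : Big V →ₗ[ℝ] Big V) : Module.Dual ℝ V →ₗ[ℝ] V :=
  LinearMap.fst ℝ V (Module.Dual ℝ V) ∘ₗ H ∘ₗ LinearMap.inr ℝ V (Module.Dual ℝ V)

/-- The `V → V` component of an endomorphism of `V ⊕ V*`. -/
def endOf (H : Big V →ₗ[ℝ] Big V) : V →ₗ[ℝ] V :=
  LinearMap.fst ℝ V (Module.Dual ℝ V) ∘ₗ H ∘ₗ LinearMap.inl ℝ V (Module.Dual ℝ V)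

theorem fst_apply_eq (H : Big V →ₗ[ℝ] Big V) (u : Big V) :
    (H u).1 = endOf H u.1 + sharpOf H u.2 := by
  have hu : u = (u.1, 0) + (0, u.2) := by simp
  conv_lhs => rw [hu, map_add]
  rfl

theorem apply_sharpOf_symm {H : Big V →ₗ[ℝ] Big V}
    (hHsymm : ∀ u v, gP V (H u) v = gP V u (H v)) (α β : Module.Dual ℝ V) :
    α (sharpOf H β) = β (sharpOf H α) := by
  have h := hHsymm (0, β) (0, α)
  simp only [gP_apply, map_zero, zero_add, add_zero] at h
  change α (H (0, β)).1 = β (H (0, α)).1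
  linarith

theorem snd_apply_inr {H : Big V →ₗ[ℝ] Big V}
    (hHsymm : ∀ u v, gP V (H u) v = gP V u (H v)) (α : Module.Dual ℝ V) (x : V) :
    (H (0, α)).2 x = α (endOf H x) := by
  have h := hHsymm (0, α) (x, 0)
  simp only [gP_apply, LinearMap.zero_apply, map_zero, add_zero] at h
  change _ = α (H (x, 0)).1
  linarith

/-- If `H² = -Id` and the `V* → V` component of `H` is injective, then the relation `H a = -b`
may be checked on `V`-components, together with that of `H b = a`. -/
theorem apply_eq_neg_iff_fst {H : Big V →ₗ[ℝ] Big V} (hH2 : ∀ u, H (H u) = -u)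
    (hinj : Function.Injective (sharpOf H)) (a b : Big V) :
    (H a = -b ∧ H b = a) ↔ (H a).1 = -b.1 ∧ (H b).1 = a.1 := by
  refine ⟨fun ⟨h₁, h₂⟩ => ⟨by rw [h₁]; rfl, by rw [h₂]⟩, fun ⟨h₁, h₂⟩ => ?_⟩
  have hd : H a + b = (0, (H a + b).2) := Prod.ext (by simp [h₁]) rfl
  have hd0 : sharpOf H (H a + b).2 = 0 := by
    change (H (0, (H a + b).2)).1 = 0
    rw [← hd, map_add, hH2]
    simp [h₂]
  have hd1 : (H a + b).2 = 0 := hinj (by rw [hd0, map_zero])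
  have hab : H a = -b := eq_neg_of_add_eq_zero_left (by rw [hd, hd1]; rfl)
  refine ⟨hab, ?_⟩
  have := hH2 a
  rw [hab, map_neg] at this
  exact neg_injective this

end

/-- Let `H` be a `g`-symmetric endomorphism of `V ⊕ V*` with `H² = -Id`
such that `(α, β) ↦ 2 g(H(0,α), (0,β))` is nondegenerate. Then there is a unique pair
`(γ₀, ψ)` of a nondegenerate symmetric bilinear form and an antisymmetric bilinear form
on `V` such that the `i`-eigenspace of `H^ℂ` is the graph of
`τ : X ↦ (X, ψ^ℂ(X,·) + i γ₀^ℂ(X,·))`. -/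
theorem eigenspace_is_graph (V : Type) [AddCommGroup V] [Module ℝ V] [FiniteDimensional ℝ V]
    (H : Big V →ₗ[ℝ] Big V)
    (hH2 : H ∘ₗ H = - LinearMap.id)
    (hHsymm : ∀ u v, gP V (H u) v = gP V u (H v))
    (hnd : ∀ α : Module.Dual ℝ V,
      (∀ β : Module.Dual ℝ V, 2 * gP V (H (0, α)) ((0 : V), β) = 0) → α = 0) :
    ∃! p : LinearMap.BilinForm ℝ V × LinearMap.BilinForm ℝ V,
      (∀ x y, p.1 x y = p.1 y x) ∧ (∀ x, (∀ y, p.1 x y = 0) → x = 0) ∧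
      (∀ x y, p.2 x y = - p.2 y x) ∧
      ((Hsp V H : Set (Bc V)) = graphSet V p.1 p.2) := by
  have hHH : ∀ u, H (H u) = -u := fun u => LinearMap.congr_fun hH2 u
  have hinj : Function.Injective (sharpOf H) := by
    refine (injective_iff_map_eq_zero _).2 fun α hα => hnd α fun β => ?_
    have hα' : (H (0, α)).1 = 0 := hα
    simp [gP_apply, hα']
  let P : Module.Dual ℝ V ≃ₗ[ℝ] V :=
    LinearEquiv.ofInjectiveOfFinrankEq (sharpOf H) hinj Subspace.dual_finrank_eq
  have hP : ∀ α, P α = sharpOf H α := fun _ => rfl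
  have hsymm : ∀ x y, P.symm x y = P.symm y x := by
    intro x y
    have h := apply_sharpOf_symm hHsymm (P.symm x) (P.symm y)
    rwa [← hP, ← hP, P.apply_symm_apply, P.apply_symm_apply] at h
  have hanti : ∀ x y, P.symm (endOf H x) y = - P.symm (endOf H y) x := by
    intro x y
    have h : endOf H x + sharpOf H (H (0, P.symm x)).2 = 0 := by
      have h₁ := fst_apply_eq H (H (0, P.symm x))
      have h₂ : (H (0, P.symm x)).1 = x := P.apply_symm_apply x
      rw [hHH, h₂] at h₁
      simpa using h₁.symm
    have h' : P.symm (endOf H x) = -(H (0, P.symm x)).2 := by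
      rw [LinearEquiv.symm_apply_eq, map_neg, hP]
      exact eq_neg_of_add_eq_zero_left h
    rw [h', LinearMap.neg_apply, snd_apply_inr hHsymm, hsymm]
  have hset : (Hsp V H : Set (Bc V)) =
      graphSet V P.symm.toLinearMap (-(P.symm.toLinearMap ∘ₗ endOf H)) := by
    ext u
    obtain ⟨a, b, rfl⟩ := exists_eq_one_tmul_add_I_tmul u
    rw [mem_Hsp_iff, mem_graphSet_iff, apply_eq_neg_iff_fst hHH hinj, fst_apply_eq, fst_apply_eq,
      ← hP, ← hP]
    have h₁ : -(P.symm.toLinearMap ∘ₗ endOf H) a.1 - P.symm.toLinearMap b.1 =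
        P.symm (-endOf H a.1 - b.1) := by simp
    have h₂ : -(P.symm.toLinearMap ∘ₗ endOf H) b.1 + P.symm.toLinearMap a.1 =
        P.symm (-endOf H b.1 + a.1) := by simp
    rw [LinearMap.neg_apply, LinearMap.neg_apply, h₁, h₂, LinearEquiv.eq_symm_apply,
      LinearEquiv.eq_symm_apply]
    refine and_congr ⟨fun h => ?_, fun h => ?_⟩ ⟨fun h => ?_, fun h => ?_⟩
    · rw [sub_eq_add_neg, ← h]; abel
    · rw [h]; abel
    · rw [← h]; abel
    · rw [h]; abel
  refine ⟨(P.symm.toLinearMap, -(P.symm.toLinearMap ∘ₗ endOf H)), ⟨hsymm, ?_, ?_, hset⟩, ?_⟩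
  · intro x hx
    exact P.symm.map_eq_zero_iff.1 (LinearMap.ext hx)
  · intro x y
    change -(P.symm (endOf H x) y) = - -(P.symm (endOf H y) x)
    rw [hanti]
  · rintro ⟨γ₁, ψ₁⟩ ⟨-, -, -, h⟩
    obtain ⟨h₁, h₂⟩ := graphSet_injective (h.symm.trans hset)
    exact Prod.ext h₁ h₂
end
end

section
/- Let (𝓕, 𝓙) be a generalized almost para-Hermitian structure on a finite-dimensional real vector space V, with 𝓗 = 𝓙∘𝓕, 𝐇 the i-eigenspace of 𝓗^ℂ, and τ : V^ℂ → 𝐇 the inverse of the projection (V ⊕ V*)^ℂ = V^ℂ ⊕ 𝐇 → V^ℂ restricted to 𝐇; write τX = (X, ψ^ℂ(X,·) + i γ₀^ℂ(X,·)) with γ₀ the associated symmetric nondegenerate form and ψ the associated 2-form on V. Define F ∈ End(V^ℂ) by F X = pr_{V^ℂ}(𝓕^ℂ(τ X)). Then F is well defined (𝓕^ℂ preserves 𝐇), F² = Id, and γ₀^ℂ(F X, Y) + γ₀^ℂ(X, F Y) = 0 for all X, Y ∈ V^ℂ. -/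
noncomputable section

open TensorProduct

attribute [local instance 3000] TensorProduct.addCommMonoid TensorProduct.leftModule

variable (V : Type) [AddCommGroup V] [Module ℝ V]

theorem gc_tmul (V : Type) [AddCommGroup V] [Module ℝ V] (a b : ℂ) (x y : Big V) :
    gc V (a ⊗ₜ x) (b ⊗ₜ y) = (b * a) * (gP V x y : ℂ) := by
  simp [gc, mul_comm]

theorem bcB_tmul (V : Type) [AddCommGroup V] [Module ℝ V] (B : LinearMap.BilinForm ℝ V)
    (a b : ℂ) (x y : V) :
    bcB V B (a ⊗ₜ x) (b ⊗ₜ y) = (b * a) * (B x y : ℂ) := by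
  simp [bcB, mul_comm]

theorem gc_symm (V : Type) [AddCommGroup V] [Module ℝ V] (u v : Bc V) :
    gc V u v = gc V v u := by
  induction u using TensorProduct.induction_on with
  | zero => simp
  | add u u' hu hu' => simp only [map_add, LinearMap.add_apply, hu, hu']
  | tmul a x =>
    induction v using TensorProduct.induction_on with
    | zero => simp
    | add v v' hv hv' => simp only [map_add, LinearMap.add_apply, hv, hv']
    | tmul b y =>
      rw [gc_tmul, gc_tmul]
      simp only [gP, LinearMap.mk₂_apply]
      push_cast
      ring

/-- The pairing metric splits as `g(u, v) = g(u, pr v) + g(v, pr u)`. -/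
theorem gc_eq_add_inV_prV (V : Type) [AddCommGroup V] [Module ℝ V] (u v : Bc V) :
    gc V u v = gc V u (inV V (prV V v)) + gc V v (inV V (prV V u)) := by
  induction u using TensorProduct.induction_on with
  | zero => simp
  | add u u' hu hu' =>
    simp only [map_add, LinearMap.add_apply, hu, hu']
    ring
  | tmul a x =>
    induction v using TensorProduct.induction_on with
    | zero => simp
    | add v v' hv hv' =>
      simp only [map_add, LinearMap.add_apply, hv, hv']
      ring
    | tmul b y =>
      simp only [inV, prV, LinearMap.baseChange_tmul, gc_tmul]
      simp only [gP, LinearMap.mk₂_apply, LinearMap.fst_apply, LinearMap.inl_apply,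
        LinearMap.zero_apply]
      push_cast
      ring

theorem bcB_symm (V : Type) [AddCommGroup V] [Module ℝ V] {B : LinearMap.BilinForm ℝ V}
    (hB : ∀ x y, B x y = B y x) (X Y : Vc V) : bcB V B X Y = bcB V B Y X := by
  induction X using TensorProduct.induction_on with
  | zero => simp
  | add X X' hX hX' => simp only [map_add, LinearMap.add_apply, hX, hX']
  | tmul a x =>
    induction Y using TensorProduct.induction_on with
    | zero => simp
    | add Y Y' hY hY' => simp only [map_add, LinearMap.add_apply, hY, hY']
    | tmul b y => rw [bcB_tmul, bcB_tmul, hB x y, mul_comm b]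

theorem bcB_antisymm (V : Type) [AddCommGroup V] [Module ℝ V] {B : LinearMap.BilinForm ℝ V}
    (hB : ∀ x y, B x y = - B y x) (X Y : Vc V) : bcB V B X Y = - bcB V B Y X := by
  induction X using TensorProduct.induction_on with
  | zero => simp
  | add X X' hX hX' =>
    simp only [map_add, LinearMap.add_apply, hX, hX']
    ring
  | tmul a x =>
    induction Y using TensorProduct.induction_on with
    | zero => simp
    | add Y Y' hY hY' =>
      simp only [map_add, LinearMap.add_apply, hY, hY']
      ring
    | tmul b y =>
      rw [bcB_tmul, bcB_tmul, hB x y]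
      push_cast
      ring

/-- A `g`-skew endomorphism stays skew after complexification. -/
theorem gc_baseChange_skew (V : Type) [AddCommGroup V] [Module ℝ V] {A : Big V →ₗ[ℝ] Big V}
    (hA : ∀ u v, gP V (A u) v = - gP V u (A v)) (u v : Bc V) :
    gc V (LinearMap.baseChange ℂ A u) v = - gc V u (LinearMap.baseChange ℂ A v) := by
  induction u using TensorProduct.induction_on with
  | zero => simp
  | add u u' hu hu' =>
    simp only [map_add, LinearMap.add_apply, hu, hu']
    ring
  | tmul a x =>
    induction v using TensorProduct.induction_on with
    | zero => simp
    | add v v' hv hv' =>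
      simp only [map_add, hv, hv']
      ring
    | tmul b y =>
      simp only [LinearMap.baseChange_tmul, gc_tmul, hA x y]
      push_cast
      ring

/-- On the graph of `ψ + i γ₀`, the pairing metric is `i γ₀`. -/
theorem gc_of_mem_graphSet (V : Type) [AddCommGroup V] [Module ℝ V]
    {γ₀ ψ : LinearMap.BilinForm ℝ V} (hsym : ∀ x y, γ₀ x y = γ₀ y x)
    (hanti : ∀ x y, ψ x y = - ψ y x) {u v : Bc V}
    (hu : u ∈ graphSet V γ₀ ψ) (hv : v ∈ graphSet V γ₀ ψ) :
    gc V u v = Complex.I * bcB V γ₀ (prV V u) (prV V v) := by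
  have h₁ := hu (prV V v)
  have h₂ := hv (prV V u)
  rw [bcB_antisymm V hanti, bcB_symm V hsym] at h₂
  rw [gc_eq_add_inV_prV]
  linear_combination (h₁ + h₂) / 2

/-- An endomorphism commuting with `H` preserves the `i`-eigenspace of `H`. -/
theorem baseChange_mem_Hsp (V : Type) [AddCommGroup V] [Module ℝ V] {A H : Big V →ₗ[ℝ] Big V}
    (hAH : H ∘ₗ A = A ∘ₗ H) {u : Bc V} (hu : u ∈ Hsp V H) :
    LinearMap.baseChange ℂ A u ∈ Hsp V H := by
  change LinearMap.baseChange ℂ H (LinearMap.baseChange ℂ A u) =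
    Complex.I • LinearMap.baseChange ℂ A u
  have hu' : LinearMap.baseChange ℂ H u = Complex.I • u := hu
  rw [← LinearMap.comp_apply, ← LinearMap.baseChange_comp, hAH, LinearMap.baseChange_comp,
    LinearMap.comp_apply, hu', map_smul]

/-- Let `(𝓕, 𝓙)` be a generalized almost para-Hermitian structure with
associated forms `γ₀` (symmetric, nondegenerate) and `ψ` (antisymmetric), `𝐇` the
`i`-eigenspace of `(𝓙∘𝓕)^ℂ` and `τ : V^ℂ → 𝐇` the inverse of the projection, so that
`τ X = (X, ψ^ℂ(X,·) + i γ₀^ℂ(X,·))`. Define `F X = pr_{V^ℂ}(𝓕^ℂ(τ X))`. Then `𝓕^ℂ`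
preserves `𝐇` (so `F` is well defined), `F² = Id`, and
`γ₀^ℂ(F X, Y) + γ₀^ℂ(X, F Y) = 0`. -/
theorem induced_F_properties (V : Type) [AddCommGroup V] [Module ℝ V]
    [FiniteDimensional ℝ V]
    (𝓕 𝓙 : Big V →ₗ[ℝ] Big V) (h : IsGAPH V 𝓕 𝓙)
    (γ₀ ψ : LinearMap.BilinForm ℝ V)
    (hsym : ∀ x y, γ₀ x y = γ₀ y x) (hnd : ∀ x, (∀ y, γ₀ x y = 0) → x = 0)
    (hanti : ∀ x y, ψ x y = - ψ y x)
    (τ : Vc V →ₗ[ℂ] Bc V)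
    (hτmem : ∀ X, τ X ∈ Hsp V (𝓙 ∘ₗ 𝓕))
    (hτonto : ∀ u ∈ Hsp V (𝓙 ∘ₗ 𝓕), ∃ X, τ X = u)
    (hτpr : ∀ X, prV V (τ X) = X)
    (hτgraph : ∀ X, τ X ∈ graphSet V γ₀ ψ) :
    (∀ u ∈ Hsp V (𝓙 ∘ₗ 𝓕), LinearMap.baseChange ℂ 𝓕 u ∈ Hsp V (𝓙 ∘ₗ 𝓕)) ∧
    (∀ X, Fop V 𝓕 τ (Fop V 𝓕 τ X) = X) ∧
    (∀ X Y, bcB V γ₀ (Fop V 𝓕 τ X) Y + bcB V γ₀ X (Fop V 𝓕 τ Y) = 0) := by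
  obtain ⟨⟨hsq, hskew⟩, -, hcomm, -⟩ := h
  have hpres : ∀ u ∈ Hsp V (𝓙 ∘ₗ 𝓕), LinearMap.baseChange ℂ 𝓕 u ∈ Hsp V (𝓙 ∘ₗ 𝓕) :=
    fun u hu => baseChange_mem_Hsp V (by rw [← LinearMap.comp_assoc, hcomm]) hu
  have hτF : ∀ X, τ (Fop V 𝓕 τ X) = LinearMap.baseChange ℂ 𝓕 (τ X) := by
    intro X
    obtain ⟨Z, hZ⟩ := hτonto _ (hpres _ (hτmem X))
    rw [Fop, ← hZ, hτpr]
  have hgτ : ∀ X Y, gc V (τ X) (τ Y) = Complex.I * bcB V γ₀ X Y := by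
    intro X Y
    rw [gc_of_mem_graphSet V hsym hanti (hτgraph X) (hτgraph Y), hτpr, hτpr]
  refine ⟨hpres, fun X => ?_, fun X Y => ?_⟩
  · have hFF : LinearMap.baseChange ℂ 𝓕 (LinearMap.baseChange ℂ 𝓕 (τ X)) = τ X := by
      rw [← LinearMap.comp_apply, ← LinearMap.baseChange_comp, hsq, LinearMap.baseChange_id,
        LinearMap.id_apply]
    rw [Fop, hτF, hFF, hτpr]
  · have key := gc_baseChange_skew V hskew (τ X) (τ Y)
    rw [← hτF, ← hτF, hgτ, hgτ] at key
    apply mul_left_cancel₀ Complex.I_ne_zero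
    linear_combination key
end
end

section
/- Let V be a finite-dimensional real vector space, let γ₀ be a nondegenerate symmetric bilinear form on V, ψ an antisymmetric bilinear form on V, and F ∈ End(V^ℂ) with F² = Id and γ₀^ℂ(F X, Y) + γ₀^ℂ(X, F Y) = 0 for all X, Y ∈ V^ℂ. Then there exists a unique generalized almost para-Hermitian structure (𝓕, 𝓙) on V such that: (i) the i-eigenspace 𝐇 of (𝓙∘𝓕)^ℂ equals the graph { (X, ψ^ℂ(X,·) + i γ₀^ℂ(X,·)) : X ∈ V^ℂ }, and (ii) the endomorphism X ↦ pr_{V^ℂ}(𝓕^ℂ(τ X)), where τ X = (X, ψ^ℂ(X,·) + i γ₀^ℂ(X,·)), equals F. Consequently, generalized almost para-Hermitian structures on V are in one-to-one correspondence with such triples (γ₀, ψ, F). -/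
noncomputable section

open TensorProduct

attribute [local instance 3000] TensorProduct.addCommMonoid TensorProduct.leftModule

variable (V : Type) [AddCommGroup V] [Module ℝ V]

section Complexification

variable {W : Type} [AddCommGroup W] [Module ℝ W]

/-- The real part of an element of `ℂ ⊗ W`. -/
def reT (W : Type) [AddCommGroup W] [Module ℝ W] : ℂ ⊗[ℝ] W →ₗ[ℝ] W :=
  (TensorProduct.lid ℝ W).toLinearMap ∘ₗ LinearMap.rTensor W Complex.reLm

/-- The imaginary part of an element of `ℂ ⊗ W`. -/
def imT (W : Type) [AddCommGroup W] [Module ℝ W] : ℂ ⊗[ℝ] W →ₗ[ℝ] W :=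
  (TensorProduct.lid ℝ W).toLinearMap ∘ₗ LinearMap.rTensor W Complex.imLm

/-- The element `a + i b` of `ℂ ⊗ W`, as a linear function of `(a, b)`. -/
def mkT (W : Type) [AddCommGroup W] [Module ℝ W] : W × W →ₗ[ℝ] ℂ ⊗[ℝ] W :=
  LinearMap.coprod (TensorProduct.mk ℝ ℂ W 1) (TensorProduct.mk ℝ ℂ W Complex.I)

lemma mkT_apply (a b : W) : mkT W (a, b) = (1 : ℂ) ⊗ₜ[ℝ] a + Complex.I ⊗ₜ[ℝ] b := rfl

@[simp] lemma reT_mkT (a b : W) : reT W (mkT W (a, b)) = a := by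
  simp [reT, mkT]

@[simp] lemma imT_mkT (a b : W) : imT W (mkT W (a, b)) = b := by
  simp [imT, mkT]

lemma mkT_reT_imT (z : ℂ ⊗[ℝ] W) : mkT W (reT W z, imT W z) = z := by
  induction z using TensorProduct.induction_on with
  | zero => rw [map_zero, map_zero, Prod.mk_zero_zero, map_zero]
  | tmul c w =>
    simp only [reT, imT, mkT_apply, LinearMap.comp_apply, LinearMap.rTensor_tmul,
      LinearEquiv.coe_coe, TensorProduct.lid_tmul, ← TensorProduct.smul_tmul,
      ← TensorProduct.add_tmul]
    congr 1
    apply Complex.ext <;> simp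
  | add x y hx hy =>
    rw [map_add, map_add, ← Prod.mk_add_mk, map_add, hx, hy]

lemma exists_eq_mkT (z : ℂ ⊗[ℝ] W) : ∃ a b, z = mkT W (a, b) :=
  ⟨_, _, (mkT_reT_imT z).symm⟩

lemma mkT_inj {a b c d : W} : mkT W (a, b) = mkT W (c, d) ↔ a = c ∧ b = d := by
  refine ⟨fun h => ⟨?_, ?_⟩, fun ⟨h, h'⟩ => by rw [h, h']⟩
  · simpa using congrArg (reT W) h
  · simpa using congrArg (imT W) h

lemma I_smul_mkT (a b : W) : Complex.I • mkT W (a, b) = mkT W (-b, a) := by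
  simp only [mkT_apply, smul_add, TensorProduct.smul_tmul', smul_eq_mul, mul_one,
    Complex.I_mul_I]
  rw [TensorProduct.tmul_neg, TensorProduct.neg_tmul, add_comm]

lemma baseChange_mkT {W' : Type} [AddCommGroup W'] [Module ℝ W'] (A : W →ₗ[ℝ] W') (a b : W) :
    LinearMap.baseChange ℂ A (mkT W (a, b)) = mkT W' (A a, A b) := by
  simp [mkT_apply]

lemma bcB_mkT (B : LinearMap.BilinForm ℝ W) (a b c d : W) :
    bcB W B (mkT W (a, b)) (mkT W (c, d)) =
      ⟨B a c - B b d, B a d + B b c⟩ := by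
  apply Complex.ext
  · simp [bcB, mkT_apply, LinearMap.BilinForm.baseChange_tmul]
    ring
  · simp [bcB, mkT_apply, LinearMap.BilinForm.baseChange_tmul]

lemma gc_mkT (a b c d : Big W) :
    gc W (mkT _ (a, b)) (mkT _ (c, d)) =
      ⟨gP W a c - gP W b d, gP W a d + gP W b c⟩ :=
  bcB_mkT (W := Big W) (gP W) a b c d

lemma prV_mkT (a b : Big W) : prV W (mkT _ (a, b)) = mkT W (a.1, b.1) :=
  baseChange_mkT _ _ _

lemma inV_mkT (a b : W) : inV W (mkT _ (a, b)) = mkT (Big W) ((a, 0), (b, 0)) :=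
  baseChange_mkT _ _ _

lemma mem_Hsp_mkT (H : Big W →ₗ[ℝ] Big W) (a b : Big W) :
    mkT _ (a, b) ∈ Hsp W H ↔ H a = -b ∧ H b = a := by
  change LinearMap.baseChange ℂ H _ = Complex.I • _ ↔ _
  rw [baseChange_mkT, I_smul_mkT, mkT_inj]

lemma mem_graphSet_mkT (γ₀ ψ : LinearMap.BilinForm ℝ W) (a b : Big W) :
    mkT _ (a, b) ∈ graphSet W γ₀ ψ ↔ a.2 = ψ a.1 - γ₀ b.1 ∧ b.2 = ψ b.1 + γ₀ a.1 := by
  constructor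
  · intro h
    have key : ∀ y, a.2 y = (ψ a.1 - γ₀ b.1) y ∧ b.2 y = (ψ b.1 + γ₀ a.1) y := by
      intro y
      have h := h (mkT W (y, 0))
      rw [inV_mkT, prV_mkT, gc_mkT, bcB_mkT, bcB_mkT] at h
      have h1 := congrArg Complex.re h
      have h2 := congrArg Complex.im h
      simp [gP] at h1 h2
      constructor <;> simp <;> linarith
    exact ⟨LinearMap.ext fun y => (key y).1, LinearMap.ext fun y => (key y).2⟩
  · rintro ⟨h1, h2⟩ Y
    obtain ⟨y, y', rfl⟩ := exists_eq_mkT Y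
    rw [inV_mkT, prV_mkT, gc_mkT, bcB_mkT, bcB_mkT]
    apply Complex.ext <;> simp [gP, h1, h2] <;> ring

end Complexification

section Graph

variable {W : Type} [AddCommGroup W] [Module ℝ W]

/-- The real linear map `x + i y ↦ (x, ψ(x,·) - γ₀(y,·))` from `W^ℂ` to `W ⊕ W*`, i.e. the real
part of `X ↦ (X, ψ^ℂ(X,·) + i γ₀^ℂ(X,·))`. -/
def graphRe (γ₀ ψ : LinearMap.BilinForm ℝ W) : Vc W →ₗ[ℝ] Big W :=
  (reT W).prod (ψ ∘ₗ reT W - γ₀ ∘ₗ imT W)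

lemma graphRe_mkT (γ₀ ψ : LinearMap.BilinForm ℝ W) (x y : W) :
    graphRe γ₀ ψ (mkT W (x, y)) = (x, ψ x - γ₀ y) := by
  simp [graphRe]

lemma graphRe_bijective [FiniteDimensional ℝ W] (γ₀ ψ : LinearMap.BilinForm ℝ W)
    (hnd : ∀ x, (∀ y, γ₀ x y = 0) → x = 0) : Function.Bijective (graphRe γ₀ ψ) := by
  have hinj : Function.Injective γ₀ := by
    rw [← LinearMap.ker_eq_bot, LinearMap.ker_eq_bot']
    exact fun x hx => hnd x fun y => by rw [hx]; rfl
  have hsurj : Function.Surjective γ₀ :=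
    (LinearMap.injective_iff_surjective_of_finrank_eq_finrank
      Subspace.dual_finrank_eq.symm).1 hinj
  constructor
  · intro z w h
    obtain ⟨x, y, rfl⟩ := exists_eq_mkT z
    obtain ⟨x', y', rfl⟩ := exists_eq_mkT w
    rw [graphRe_mkT, graphRe_mkT, Prod.mk.injEq] at h
    obtain ⟨rfl, h⟩ := h
    rw [hinj (sub_right_injective h)]
  · rintro ⟨x, α⟩
    obtain ⟨y, hy⟩ := hsurj (ψ x - α)
    exact ⟨mkT W (x, y), by rw [graphRe_mkT, hy, sub_sub_cancel]⟩

lemma gP_graphRe {γ₀ ψ : LinearMap.BilinForm ℝ W} (hsym : ∀ x y, γ₀ x y = γ₀ y x)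
    (hanti : ∀ x y, ψ x y = - ψ y x) (z w : Vc W) :
    gP W (graphRe γ₀ ψ z) (graphRe γ₀ ψ w) = - (bcB W γ₀ z w).im / 2 := by
  obtain ⟨x, y, rfl⟩ := exists_eq_mkT z
  obtain ⟨x', y', rfl⟩ := exists_eq_mkT w
  rw [graphRe_mkT, graphRe_mkT, bcB_mkT]
  simp only [gP, LinearMap.mk₂_apply, LinearMap.sub_apply]
  rw [hanti x x', hsym y' x]
  ring

lemma mem_graphSet_iff_s6 (γ₀ ψ : LinearMap.BilinForm ℝ W) (u : Bc W) :
    u ∈ graphSet W γ₀ ψ ↔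
      ∃ z, u = mkT _ (graphRe γ₀ ψ z, - graphRe γ₀ ψ (Complex.I • z)) := by
  obtain ⟨a, b, rfl⟩ := exists_eq_mkT u
  rw [mem_graphSet_mkT]
  constructor
  · rintro ⟨h1, h2⟩
    refine ⟨mkT W (a.1, b.1), ?_⟩
    rw [I_smul_mkT, graphRe_mkT, graphRe_mkT, mkT_inj]
    refine ⟨Prod.ext rfl h1, Prod.ext (by simp) ?_⟩
    rw [h2]
    simp [add_comm]
  · rintro ⟨z, hz⟩
    obtain ⟨x, y, rfl⟩ := exists_eq_mkT z
    rw [I_smul_mkT, graphRe_mkT, graphRe_mkT, mkT_inj] at hz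
    obtain ⟨rfl, rfl⟩ := hz
    simp [add_comm]

lemma prV_mkT_graphRe (γ₀ ψ : LinearMap.BilinForm ℝ W) (z : Vc W) :
    prV W (mkT _ (graphRe γ₀ ψ z, - graphRe γ₀ ψ (Complex.I • z))) = z := by
  obtain ⟨x, y, rfl⟩ := exists_eq_mkT z
  rw [I_smul_mkT, graphRe_mkT, graphRe_mkT, prV_mkT]
  simp

lemma exists_transport [FiniteDimensional ℝ W] (γ₀ ψ : LinearMap.BilinForm ℝ W)
    (hnd : ∀ x, (∀ y, γ₀ x y = 0) → x = 0) (A : Vc W →ₗ[ℂ] Vc W) :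
    ∃ B : Big W →ₗ[ℝ] Big W, ∀ z, B (graphRe γ₀ ψ z) = graphRe γ₀ ψ (A z) := by
  let e := LinearEquiv.ofBijective (graphRe γ₀ ψ) (graphRe_bijective γ₀ ψ hnd)
  let A' : Vc W →ₗ[ℝ] Vc W := A.restrictScalars ℝ
  refine ⟨graphRe γ₀ ψ ∘ₗ A' ∘ₗ e.symm.toLinearMap, fun z => ?_⟩
  change graphRe γ₀ ψ (A (e.symm (e z))) = _
  rw [e.symm_apply_apply]

end Graph


/-- Given a nondegenerate symmetric bilinear form `γ₀`, an antisymmetric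
bilinear form `ψ` on `V`, and `F ∈ End(V^ℂ)` with `F² = Id` and
`γ₀^ℂ(FX,Y) + γ₀^ℂ(X,FY) = 0`, there is a unique generalized almost para-Hermitian
structure `(𝓕, 𝓙)` on `V` such that (i) the `i`-eigenspace `𝐇` of `(𝓙∘𝓕)^ℂ` is the
graph of `τ : X ↦ (X, ψ^ℂ(X,·) + i γ₀^ℂ(X,·))`, and (ii) the induced endomorphism of
`V^ℂ` (acting on `𝐇` through the first component) equals `F`. Hence generalized almost
para-Hermitian structures correspond bijectively to such triples `(γ₀, ψ, F)`. -/
theorem structure_from_triple (V : Type) [AddCommGroup V] [Module ℝ V]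
    [FiniteDimensional ℝ V]
    (γ₀ ψ : LinearMap.BilinForm ℝ V)
    (hsym : ∀ x y, γ₀ x y = γ₀ y x) (hnd : ∀ x, (∀ y, γ₀ x y = 0) → x = 0)
    (hanti : ∀ x y, ψ x y = - ψ y x)
    (F : Vc V →ₗ[ℂ] Vc V)
    (hF2 : F ∘ₗ F = LinearMap.id)
    (hFsk : ∀ X Y, bcB V γ₀ (F X) Y + bcB V γ₀ X (F Y) = 0) :
    ∃! p : (Big V →ₗ[ℝ] Big V) × (Big V →ₗ[ℝ] Big V),
      IsGAPH V p.1 p.2 ∧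
      ((Hsp V (p.2 ∘ₗ p.1) : Set (Bc V)) = graphSet V γ₀ ψ) ∧
      (∀ u ∈ Hsp V (p.2 ∘ₗ p.1), prV V (LinearMap.baseChange ℂ p.1 u) = F (prV V u)) := by
  have hsurj := (graphRe_bijective γ₀ ψ hnd).2
  have hFF : ∀ z, F (F z) = z := fun z => LinearMap.congr_fun hF2 z
  have hII : ∀ z : Vc V, Complex.I • Complex.I • z = -z := fun z => by
    obtain ⟨x, y, rfl⟩ := exists_eq_mkT z
    rw [I_smul_mkT, I_smul_mkT, ← map_neg, Prod.neg_mk]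
  have hsk : ∀ X Y, bcB V γ₀ (F X) Y = - bcB V γ₀ X (F Y) := fun X Y =>
    eq_neg_of_add_eq_zero_left (hFsk X Y)
  obtain ⟨𝓕, h𝓕⟩ := exists_transport γ₀ ψ hnd F
  obtain ⟨𝓙, h𝓙⟩ := exists_transport γ₀ ψ hnd (Complex.I • F)
  replace h𝓙 : ∀ z, 𝓙 (graphRe γ₀ ψ z) = graphRe γ₀ ψ (Complex.I • F z) := h𝓙
  have h𝓗 : ∀ z, (𝓙 ∘ₗ 𝓕) (graphRe γ₀ ψ z) = graphRe γ₀ ψ (Complex.I • z) := fun z => by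
    rw [LinearMap.comp_apply, h𝓕, h𝓙, hFF]
  have hskF : ∀ u v, gP V (𝓕 u) v = - gP V u (𝓕 v) := by
    intro u v
    obtain ⟨z, rfl⟩ := hsurj u
    obtain ⟨w, rfl⟩ := hsurj v
    rw [h𝓕, h𝓕, gP_graphRe hsym hanti, gP_graphRe hsym hanti, hsk, Complex.neg_im]
    ring
  have hHsp : (Hsp V (𝓙 ∘ₗ 𝓕) : Set (Bc V)) = graphSet V γ₀ ψ := by
    ext u
    rw [SetLike.mem_coe, mem_graphSet_iff_s6]
    constructor
    · obtain ⟨a, b, rfl⟩ := exists_eq_mkT u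
      rw [mem_Hsp_mkT]
      rintro ⟨h, -⟩
      obtain ⟨z, rfl⟩ := hsurj a
      exact ⟨z, by rw [← h𝓗, h, neg_neg]⟩
    · rintro ⟨z, rfl⟩
      rw [mem_Hsp_mkT, neg_neg, map_neg, h𝓗, h𝓗, hII, map_neg, neg_neg]
      exact ⟨rfl, rfl⟩
  refine ⟨(𝓕, 𝓙), ⟨⟨⟨?_, hskF⟩, ⟨?_, ?_⟩, ?_, ?_⟩, hHsp, ?_⟩, ?_⟩
  · refine LinearMap.ext fun u => ?_
    obtain ⟨z, rfl⟩ := hsurj u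
    rw [LinearMap.comp_apply, h𝓕, h𝓕, hFF, LinearMap.id_apply]
  · refine LinearMap.ext fun u => ?_
    obtain ⟨z, rfl⟩ := hsurj u
    rw [LinearMap.comp_apply, h𝓙, h𝓙, map_smul F, hFF, hII, map_neg]
    rfl
  · intro u v
    obtain ⟨z, rfl⟩ := hsurj u
    obtain ⟨w, rfl⟩ := hsurj v
    rw [h𝓙, h𝓙, gP_graphRe hsym hanti, gP_graphRe hsym hanti, map_smul, map_smul,
      LinearMap.smul_apply, hsk, smul_neg, Complex.neg_im]
    ring
  · refine LinearMap.ext fun u => ?_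
    obtain ⟨z, rfl⟩ := hsurj u
    rw [LinearMap.comp_apply, LinearMap.comp_apply, h𝓙, h𝓕, h𝓕, h𝓙, map_smul]
  · intro α h
    refine LinearMap.ext fun y => ?_
    have hy := h (-γ₀ y)
    have e : ((0, -γ₀ y) : Big V) = graphRe γ₀ ψ (mkT V (0, y)) := by
      rw [graphRe_mkT, map_zero, zero_sub]
    rw [gammaOf, hskF, e, h𝓙, h𝓕, map_smul, hFF, I_smul_mkT, graphRe_mkT] at hy
    simpa [gP] using hy
  · intro u hu
    obtain ⟨z, rfl⟩ := (mem_graphSet_iff_s6 γ₀ ψ u).1 (hHsp ▸ hu)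
    rw [baseChange_mkT, map_neg, h𝓕, h𝓕, map_smul, prV_mkT_graphRe, prV_mkT_graphRe]
  · rintro ⟨F', J'⟩ ⟨⟨⟨hFF', -⟩, -, hcomm, -⟩, hH', hpr⟩
    dsimp only at hFF' hcomm hH' hpr
    have hmem : ∀ z, mkT _ (graphRe γ₀ ψ z, - graphRe γ₀ ψ (Complex.I • z)) ∈
        Hsp V (J' ∘ₗ F') := fun z => by
      rw [← SetLike.mem_coe, hH', mem_graphSet_iff_s6]
      exact ⟨z, rfl⟩
    have hJF : ∀ z, J' (F' (graphRe γ₀ ψ z)) = graphRe γ₀ ψ (Complex.I • z) := fun z => by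
      simpa using ((mem_Hsp_mkT _ _ _).1 (hmem z)).1
    have hF' : ∀ z, F' (graphRe γ₀ ψ z) = graphRe γ₀ ψ (F z) := by
      intro z
      obtain ⟨w, hw⟩ := hsurj (F' (graphRe γ₀ ψ z))
      have h1 : F' (graphRe γ₀ ψ (Complex.I • z)) = graphRe γ₀ ψ (Complex.I • w) := by
        rw [← hJF z, ← hJF w, hw]
        exact LinearMap.congr_fun hcomm _
      have h2 := hpr _ (hmem z)
      rw [baseChange_mkT, map_neg, h1, ← hw, prV_mkT_graphRe, prV_mkT_graphRe] at h2
      rw [← hw, h2]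
    have hJ' : ∀ z, J' (graphRe γ₀ ψ z) = graphRe γ₀ ψ (Complex.I • F z) := by
      intro z
      rw [← hJF, hF', hFF]
    refine Prod.ext (LinearMap.ext fun u => ?_) (LinearMap.ext fun u => ?_)
    · obtain ⟨z, rfl⟩ := hsurj u
      exact (hF' z).trans (h𝓕 z).symm
    · obtain ⟨z, rfl⟩ := hsurj u
      exact (hJ' z).trans (h𝓙 z).symm
end
end

section
/- Let V be a finite-dimensional real vector space with a nondegenerate symmetric bilinear form γ₀ and a real endomorphism J of V with J² = -Id and γ₀(J X, Y) + γ₀(X, J Y) = 0 (a classical almost pseudo-Hermitian structure). Define endomorphisms of V ⊕ V* by 𝓙(X, α) = (J X, -α∘J), 𝓗(X, α) = (♯_{γ₀} α, -γ₀(X,·)) where ♯_{γ₀} is the inverse of X ↦ γ₀(X,·), and 𝓕 = -𝓙∘𝓗, i.e. 𝓕(X, α) = (-J(♯_{γ₀} α), γ₀(J X, ·)). Then 𝓕 is a generalized almost para-complex structure, 𝓙 is a generalized almost complex structure, 𝓕 and 𝓙 commute, and the bilinear form γ(α, β) = -2 g(𝓕(0,α), 𝓙(0,β)) on V* is nondegenerate;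 hence every classical almost pseudo-Hermitian structure gives rise to a generalized almost para-Hermitian structure (𝓕, 𝓙) on V. -/
noncomputable section

open TensorProduct

attribute [local instance 3000] TensorProduct.addCommMonoid TensorProduct.leftModule

variable (V : Type) [AddCommGroup V] [Module ℝ V]

/-- A classical almost pseudo-Hermitian structure `(γ₀, J)` on `V`
(`J² = -Id`, `γ₀(JX,Y) + γ₀(X,JY) = 0`) gives rise to a generalized almost
para-Hermitian structure: with `𝓙(X,α) = (JX, -α∘J)` and
`𝓕(X,α) = (-J(♯_{γ₀}α), γ₀(JX,·))`, the pair `(𝓕, 𝓙)` consists of a generalized almost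
para-complex and a generalized almost complex structure, they commute, and the induced
form `γ` on `V*` is nondegenerate. -/
theorem classical_pseudo_hermitian (V : Type) [AddCommGroup V] [Module ℝ V]
    [FiniteDimensional ℝ V]
    (γ₀ : LinearMap.BilinForm ℝ V)
    (hsym : ∀ x y, γ₀ x y = γ₀ y x) (hnd : ∀ x, (∀ y, γ₀ x y = 0) → x = 0)
    (J : V →ₗ[ℝ] V) (hJ2 : J ∘ₗ J = - LinearMap.id)
    (hJsk : ∀ X Y, γ₀ (J X) Y + γ₀ X (J Y) = 0)
    (sharp : Module.Dual ℝ V →ₗ[ℝ] V)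
    (hsharp₁ : ∀ X, sharp (γ₀ X) = X) (hsharp₂ : ∀ α, γ₀ (sharp α) = α) :
    IsGenParaCx V
      (LinearMap.prod (- (J ∘ₗ sharp ∘ₗ LinearMap.snd ℝ V (Module.Dual ℝ V)))
        ((γ₀ ∘ₗ J) ∘ₗ LinearMap.fst ℝ V (Module.Dual ℝ V))) ∧
    IsGenCx V (genF V J) ∧
    (LinearMap.prod (- (J ∘ₗ sharp ∘ₗ LinearMap.snd ℝ V (Module.Dual ℝ V)))
        ((γ₀ ∘ₗ J) ∘ₗ LinearMap.fst ℝ V (Module.Dual ℝ V)) ∘ₗ genF V J =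
      genF V J ∘ₗ
        LinearMap.prod (- (J ∘ₗ sharp ∘ₗ LinearMap.snd ℝ V (Module.Dual ℝ V)))
          ((γ₀ ∘ₗ J) ∘ₗ LinearMap.fst ℝ V (Module.Dual ℝ V))) ∧
    (∀ α, (∀ β, gammaOf V
        (LinearMap.prod (- (J ∘ₗ sharp ∘ₗ LinearMap.snd ℝ V (Module.Dual ℝ V)))
          ((γ₀ ∘ₗ J) ∘ₗ LinearMap.fst ℝ V (Module.Dual ℝ V)))
        (genF V J) α β = 0) → α = 0) := by
  have hJJ : ∀ x, J (J x) = -x := fun x => by simpa using LinearMap.congr_fun hJ2 x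
  have hJr : ∀ x y, γ₀ x (J y) = - γ₀ (J x) y := fun x y => by linarith [hJsk x y]
  have hex : ∀ α : Module.Dual ℝ V, ∃ a, α = γ₀ a := fun α => ⟨sharp α, (hsharp₂ α).symm⟩
  have hdual : ∀ a, J.dualMap (γ₀ a) = - γ₀ (J a) := fun a => by
    ext y
    simpa using hJr a y
  refine ⟨⟨?_, ?_⟩, ⟨?_, ?_⟩, ?_, ?_⟩
  · refine LinearMap.ext fun ⟨x, α⟩ => ?_
    obtain ⟨a, rfl⟩ := hex α
    simp [hsharp₁, hJJ]
  · rintro ⟨x, α⟩ ⟨y, β⟩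
    obtain ⟨a, rfl⟩ := hex α
    obtain ⟨b, rfl⟩ := hex β
    simp only [gP, LinearMap.mk₂_apply, LinearMap.prod_apply, Function.prod_apply,
      LinearMap.neg_apply, LinearMap.comp_apply, LinearMap.fst_apply, LinearMap.snd_apply,
      hsharp₁, map_neg]
    linarith [hJsk x y, hJsk b a, hsym x (J y), hsym a (J b)]
  · refine LinearMap.ext fun ⟨x, α⟩ => ?_
    obtain ⟨a, rfl⟩ := hex α
    simp [genF, hdual, hJJ]
  · rintro ⟨x, α⟩ ⟨y, β⟩
    simp [gP, genF]
    ring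
  · refine LinearMap.ext fun ⟨x, α⟩ => ?_
    obtain ⟨a, rfl⟩ := hex α
    simp [genF, hdual, hJJ, hsharp₁]
  · intro α h
    obtain ⟨a, rfl⟩ := hex α
    have ha : a = 0 := hnd a fun b => by
      have hb := h (γ₀ b)
      simp [gammaOf, gP, genF, hsharp₁, hJJ] at hb
      rw [hsym a b]
      exact hb
    rw [ha, map_zero]
end
end
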